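/- Let n, d, m be positive integers, let ε ∈ (0,1), let A ∈ ℝ^{n×d}, b ∈ ℝⁿ, and let Π ∈ ℝ^{m×n} be a matrix such that for every vector y in the linear span of b and the columns of A one has (1 − ε)‖y‖₂ ≤ ‖Πy‖₂ ≤ (1 + ε)‖y‖₂. If x̃ ∈ ℝ^d minimizes ‖ΠAx − Πb‖₂ over all x ∈ ℝ^d, then ‖Ax̃ − b‖₂ ≤ ((1 + ε)/(1 − ε)) · min_{x ∈ ℝ^d} ‖Ax − b‖₂. -/

import Mathlib

open Matrix

/-- Euclidean norm of a vector in `ℝ^k`. -/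
noncomputable def euclNorm {k : ℕ} (v : Fin k → ℝ) : ℝ := Real.sqrt (∑ i, (v i) ^ 2)

/-- If `Π` preserves up to `1 ± ε` the norm of every vector in the span of `b` and the
columns of `A`, then any minimizer `xtilde` of `‖ΠAx − Πb‖` satisfies
`‖Axtilde − b‖ ≤ ((1+ε)/(1−ε)) · min_x ‖Ax − b‖`. -/
theorem sketched_least_squares
    (n d m : ℕ) (hn : 0 < n) (hd : 0 < d) (hm : 0 < m)
    (ε : ℝ) (hε : ε ∈ Set.Ioo (0 : ℝ) 1)
    (A : Matrix (Fin n) (Fin d) ℝ) (b : Fin n → ℝ)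
    (P : Matrix (Fin m) (Fin n) ℝ)
    -- `Π` preserves norms of all vectors in span(b, columns of A)
    (hembed : ∀ (x : Fin d → ℝ) (t : ℝ),
      (1 - ε) * euclNorm (A.mulVec x + t • b)
          ≤ euclNorm (P.mulVec (A.mulVec x + t • b)) ∧
      euclNorm (P.mulVec (A.mulVec x + t • b))
          ≤ (1 + ε) * euclNorm (A.mulVec x + t • b))
    (xtilde : Fin d → ℝ)
    (hmin : ∀ x : Fin d → ℝ,
      euclNorm ((P * A).mulVec xtilde - P.mulVec b) ≤ euclNorm ((P * A).mulVec x - P.mulVec b)) :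
    ∀ x : Fin d → ℝ,
      euclNorm (A.mulVec xtilde - b) ≤ ((1 + ε) / (1 - ε)) * euclNorm (A.mulVec x - b) := by
  intro x
  obtain ⟨-, hε1⟩ := hε
  have residual : ∀ z : Fin d → ℝ,
      (1 - ε) * euclNorm (A.mulVec z - b) ≤ euclNorm ((P * A).mulVec z - P.mulVec b) ∧
      euclNorm ((P * A).mulVec z - P.mulVec b) ≤ (1 + ε) * euclNorm (A.mulVec z - b) := by
    intro z
    have h := hembed z (-1)
    rwa [neg_one_smul, ← sub_eq_add_neg, Matrix.mulVec_sub, Matrix.mulVec_mulVec] at h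
  rw [div_mul_eq_mul_div, le_div_iff₀' (sub_pos.mpr hε1)]
  exact (residual xtilde).1.trans ((hmin x).trans (residual x).2)
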